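/- Let G be a finite group of order n. Then every sequence of 2n - 1 elements of G contains a subsequence of length n whose elements, in some order, multiply to the identity. In particular E(G) ≤ 2|G| - 1. -/

import Mathlib

/-- The set of products of a sequence (multiset) `S` over all orderings. -/
def piSet {G : Type*} [Group G] (S : Multiset G) : Set G :=
  {g | ∃ l : List G, (l : Multiset G) = S ∧ l.prod = g}

/-- `E(G)`: the least `t` such that every sequence of length `t` over `G` has a
product-one subsequence of length `|G|`. -/
noncomputable def EG (G : Type*) [Group G] [Fintype G] : ℕ :=
  sInf {t | ∀ S : Multiset G, Multiset.card S = t →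
    ∃ T, T ≤ S ∧ Multiset.card T = Fintype.card G ∧ (1 : G) ∈ piSet T}

section ProductOne

open Classical Pointwise Finset MulOpposite

section Atoms

variable {G : Type*} [Group G]

theorem card_smul_sdiff_pos {u : G} {X : Finset G} (h : u • X ≠ X) : 0 < #(u • X \ X) := by
  rw [Finset.card_pos, sdiff_nonempty]
  exact fun hs => h (eq_of_subset_of_card_le hs (by rw [card_smul_finset]))

/-- The boundary size `X ↦ #(u • X \ X)` is submodular. -/
theorem card_smul_inter_sdiff_add_card_smul_union_sdiff_le (u : G) (X Y : Finset G) :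
    #(u • (X ∩ Y) \ (X ∩ Y)) + #(u • (X ∪ Y) \ (X ∪ Y)) ≤ #(u • X \ X) + #(u • Y \ Y) := by
  rw [← card_union_add_card_inter, ← card_union_add_card_inter (u • X \ X)]
  rw [smul_finset_inter, smul_finset_union]
  refine add_le_add (card_le_card ?_) (card_le_card ?_) <;> grind

/-- If `Q` is invariant under left translation by the subgroup `H` but not by `u`, then
translating by `u` moves at least `|H|` elements out of `Q`. -/
theorem card_le_card_smul_sdiff [Fintype G] (H : Subgroup G) (u : G) (Q : Finset G)
    (hH : ∀ h ∈ H, h • Q = Q) (hu : u • Q ≠ Q) : Nat.card H ≤ #(u • Q \ Q) := by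
  let F : Finset (Finset G) := {X : Finset G | (∀ h ∈ H, h • X = X) ∧ u • X ≠ X}
  obtain ⟨X, hXF, hmin⟩ := F.exists_min_image (fun X : Finset G => toLex (#(u • X \ X), #X))
    ⟨Q, by simpa [F] using ⟨hH, hu⟩⟩
  have memF : ∀ Y : Finset G, Y ∈ F ↔ (∀ h ∈ H, h • Y = Y) ∧ u • Y ≠ Y := fun Y => by simp [F]
  obtain ⟨hXH, hXu⟩ := (memF X).1 hXF
  have hmin₁ : ∀ Y : Finset G, (∀ h ∈ H, h • Y = Y) → u • Y ≠ Y → #(u • X \ X) ≤ #(u • Y \ Y) := by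
    intro Y h1 h2
    have := Prod.Lex.le_iff.1 (hmin Y ((memF Y).2 ⟨h1, h2⟩))
    simp at this; lia
  have hmin₂ : ∀ Y : Finset G, (∀ h ∈ H, h • Y = Y) → u • Y ≠ Y → #(u • Y \ Y) ≤ #(u • X \ X) →
      #X ≤ #Y := by
    intro Y h1 h2 h3
    have := Prod.Lex.le_iff.1 (hmin Y ((memF Y).2 ⟨h1, h2⟩))
    simp at this; lia
  have hpos := card_smul_sdiff_pos hXu
  have hne : ∀ Z : Finset G, 0 < #(u • Z \ Z) → u • Z ≠ Z := by
    intro Z hZ h; simp [h] at hZ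
  have block : ∀ c : G, (X ∩ op c • X).Nonempty → op c • X = X := by
    intro c hc
    set Y := op c • X with hY
    have hYH : ∀ h ∈ H, h • Y = Y := fun h hh => by rw [hY, smul_comm, hXH h hh]
    have hYX : #Y = #X := card_smul_finset _ _
    have hYf : #(u • Y \ Y) = #(u • X \ X) := by
      rw [hY, smul_comm, ← smul_finset_sdiff, card_smul_finset]
    have hcard : 0 < #(X ∩ Y) := card_pos.2 hc
    have hsub := card_smul_inter_sdiff_add_card_smul_union_sdiff_le u X Y
    have hIH : ∀ h ∈ H, h • (X ∩ Y) = X ∩ Y := fun h hh => by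
      rw [smul_finset_inter, hXH h hh, hYH h hh]
    have hUH : ∀ h ∈ H, h • (X ∪ Y) = X ∪ Y := fun h hh => by
      rw [smul_finset_union, hXH h hh, hYH h hh]
    by_cases hI : u • (X ∩ Y) = X ∩ Y
    · exfalso
      have hD : u • (X \ (X ∩ Y)) \ (X \ (X ∩ Y)) = u • X \ X := by
        rw [smul_finset_sdiff, hI, sdiff_sdiff_sdiff_cancel_right inter_subset_left]
      have := hmin₂ (X \ (X ∩ Y)) (fun h hh => by rw [smul_finset_sdiff, hXH h hh, hIH h hh])
        (hne _ (by rwa [hD])) (by rw [hD])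
      have h2 := card_sdiff_add_card_inter X (X ∩ Y)
      rw [inter_eq_right.2 inter_subset_left] at h2
      lia
    by_cases hU : u • (X ∪ Y) = X ∪ Y
    · exfalso
      have hD : #(u • ((X ∪ Y) \ X) \ ((X ∪ Y) \ X)) = #(u • X \ X) := by
        have h1 : u • ((X ∪ Y) \ X) \ ((X ∪ Y) \ X) = X \ u • X := by
          rw [smul_finset_sdiff, hU, sdiff_sdiff_sdiff_cancel_left subset_union_left]
        rw [h1]
        have h2 := card_sdiff_add_card_inter X (u • X)
        have h3 := card_sdiff_add_card_inter (u • X) X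
        rw [inter_comm, card_smul_finset] at h3
        lia
      have := hmin₂ ((X ∪ Y) \ X) (fun h hh => by rw [smul_finset_sdiff, hUH h hh, hXH h hh])
        (hne _ (by rwa [hD])) hD.le
      have h2 := card_sdiff_add_card_inter Y X
      rw [inter_comm] at h2
      rw [union_sdiff_left] at this
      lia
    have h1 := hmin₁ _ hIH hI
    have h2 := hmin₁ _ hUH hU
    have h3 := hmin₂ _ hIH hI (by lia)
    have h4 : X ∩ Y = X := eq_of_subset_of_card_le inter_subset_left h3
    exact (eq_of_subset_of_card_le (inter_eq_left.1 h4) hYX.le).symm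
  refine le_trans ?_ (hmin₁ Q hH hu)
  obtain ⟨z, hz⟩ := card_pos.1 hpos
  rw [mem_sdiff, mem_smul_finset] at hz
  obtain ⟨⟨x, hx, rfl⟩, hux⟩ := hz
  have hdisj : Disjoint (u • X) X := by
    rw [disjoint_left]
    rintro _ hw hwX
    obtain ⟨y, hy, rfl⟩ := mem_smul_finset.1 hw
    apply hux
    have hb := block (y⁻¹ * x) ⟨x, mem_inter.2 ⟨hx, mem_smul_finset.2 ⟨y, hy, by simp⟩⟩⟩
    rw [← hb]
    exact mem_smul_finset.2 ⟨u • y, hwX, by simp [mul_assoc]⟩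
  rw [sdiff_eq_self_of_disjoint hdisj, card_smul_finset, ← Fintype.card_eq_nat_card,
    ← Fintype.card_coe]
  refine Fintype.card_le_of_injective
    (fun h : H => (⟨h * x, by rw [← hXH h h.2]; exact smul_mem_smul_finset hx⟩ : X)) ?_
  intro a b hab
  simpa using hab

end Atoms

section Realization

variable {G : Type*} [Group G]

theorem Multiset.exists_le_card_eq {α : Type*} {s : Multiset α} {n : ℕ} (h : n ≤ card s) :
    ∃ t ≤ s, card t = n := by
  have : 0 < card (powersetCard n s) := by
    rw [card_powersetCard]; exact Nat.choose_pos h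
  obtain ⟨t, ht⟩ := card_pos_iff_exists_mem.1 this
  exact ⟨t, mem_powersetCard.1 ht⟩

/-- If the first conjugate of `h` by a power of `x` escaping the subgroup `K` is the `j`-th one,
then `K` has at least `2 ^ j` elements. -/
theorem two_pow_le_card_of_conj_mem [Finite G] {x h : G} (j : ℕ) :
    ∀ K : Subgroup G, (∀ i < j, (x ^ i)⁻¹ * h * x ^ i ∈ K) → (x ^ j)⁻¹ * h * x ^ j ∉ K →
      2 ^ j ≤ Nat.card K := by
  induction j with
  | zero => intro K _ _; simpa using Nat.one_le_iff_ne_zero.2 Nat.card_pos.ne'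
  | succ j ih =>
    intro K h₁ h₂
    let K' : Subgroup G := K ⊓ K.comap (MulAut.conj x⁻¹).toMonoidHom
    have hK' : ∀ y, y ∈ K' ↔ y ∈ K ∧ x⁻¹ * y * x ∈ K := fun y => by
      simp [K', Subgroup.mem_inf]
    have key : ∀ i : ℕ, x⁻¹ * ((x ^ i)⁻¹ * h * x ^ i) * x = (x ^ (i + 1))⁻¹ * h * x ^ (i + 1) := by
      intro i; rw [pow_succ]; group
    have hn : (x ^ j)⁻¹ * h * x ^ j ∉ K' := fun hm => h₂ (by rw [← key]; exact ((hK' _).1 hm).2)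
    have h₃ := ih K' (fun i hi => (hK' _).2 ⟨h₁ i (by lia), by rw [key]; exact h₁ _ (by lia)⟩) hn
    obtain ⟨c, hc⟩ := Subgroup.card_dvd_of_le (inf_le_left : K' ≤ K)
    have hc0 : c ≠ 0 := by rintro rfl; simp at hc; exact absurd hc Nat.card_pos.ne'
    have hc1 : c ≠ 1 := by
      rintro rfl
      rw [mul_one] at hc
      have : K' = K := Subgroup.eq_of_le_of_card_ge inf_le_left hc.le
      exact hn (this ▸ h₁ j (by lia))
    rw [hc, pow_succ]
    exact Nat.mul_le_mul h₃ (by lia)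

/-- Every element of `P` is the product of some `ℓ` terms of `U`, taken in a suitable order. -/
def Realizes (U : Multiset G) (ℓ : ℕ) (P : Finset G) : Prop :=
  ∀ p ∈ P, ∃ l : List G, (l : Multiset G) ≤ U ∧ l.length = ℓ ∧ l.prod = p

theorem Realizes.union {U : Multiset G} {ℓ : ℕ} {P Q : Finset G} (hP : Realizes U ℓ P)
    (hQ : Realizes U ℓ Q) : Realizes U ℓ (P ∪ Q) := by
  intro p hp
  rcases mem_union.1 hp with h | h
  exacts [hP p h, hQ p h]

theorem Realizes.prod_smul {U W : Multiset G} {ℓ : ℕ} {P : Finset G} (hP : Realizes U ℓ P)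
    {l : List G} (hl : (l : Multiset G) ≤ W) : Realizes (U + W) (ℓ + l.length) (l.prod • P) := by
  intro p hp
  obtain ⟨q, hq, rfl⟩ := mem_smul_finset.1 hp
  obtain ⟨m, hm, hml, rfl⟩ := hP q hq
  refine ⟨l ++ m, ?_, by simp [hml, add_comm], by simp⟩
  rw [← Multiset.coe_add, add_comm]
  exact add_le_add hm hl

theorem Realizes.op_smul {U W : Multiset G} {ℓ : ℕ} {P : Finset G} (hP : Realizes U ℓ P)
    {a : G} (ha : a ∈ W) : Realizes (U + W) (ℓ + 1) (op a • P) := by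
  intro p hp
  obtain ⟨q, hq, rfl⟩ := mem_smul_finset.1 hp
  obtain ⟨m, hm, hml, rfl⟩ := hP q hq
  refine ⟨m ++ [a], ?_, by simp [hml], by simp⟩
  rw [← Multiset.coe_add]
  exact add_le_add hm (by simpa using ha)

variable [Fintype G]

/-- The left coset `gN` as a finset. -/
noncomputable def coset (g : G) (N : Subgroup G) : Finset G := {a | g⁻¹ * a ∈ N}

theorem mem_coset {g a : G} {N : Subgroup G} : a ∈ coset g N ↔ g⁻¹ * a ∈ N := by
  simp [coset]

theorem self_mem_coset (g : G) (N : Subgroup G) : g ∈ coset g N := by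
  simp [mem_coset, N.one_mem]

theorem card_coset (g : G) (N : Subgroup G) : #(coset g N) = Nat.card N := by
  rw [← Nat.subtype_card (p := fun a => g⁻¹ * a ∈ N) _ fun a => mem_coset]
  exact Nat.card_congr ((Equiv.mulLeft g⁻¹).subtypeEquiv fun a => by simp)

theorem coset_subset_coset {g x : G} {M N : Subgroup G} (hMN : M ≤ N) (hx : x ∈ coset g N) :
    coset x M ⊆ coset g N := by
  intro a ha
  rw [mem_coset] at *
  simpa [mul_assoc] using N.mul_mem hx (hMN ha)

theorem mem_normalizer_of_mem_coset {g x : G} {N : Subgroup G}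
    (hg : g ∈ Subgroup.normalizer (N : Set G)) (hx : x ∈ coset g N) :
    x ∈ Subgroup.normalizer (N : Set G) := by
  simpa using mul_mem hg (Subgroup.le_normalizer (mem_coset.1 hx))

theorem mul_mem_coset_mul {g a b h : G} {N : Subgroup G}
    (hh : h ∈ Subgroup.normalizer (N : Set G)) (ha : a ∈ coset g N) (hb : b ∈ coset h N) :
    a * b ∈ coset (g * h) N := by
  rw [mem_coset] at *
  have := (Subgroup.mem_normalizer_iff.1 (inv_mem hh) (g⁻¹ * a)).1 ha
  have := N.mul_mem this hb
  simpa [mul_assoc] using this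

theorem prod_mem_coset {g : G} {N : Subgroup G} (hg : g ∈ Subgroup.normalizer (N : Set G)) :
    ∀ l : List G, (∀ a ∈ l, a ∈ coset g N) → l.prod ∈ coset (g ^ l.length) N := by
  intro l
  induction l with
  | nil => intro _; simpa using self_mem_coset 1 N
  | cons a l ih =>
    intro h
    rw [List.prod_cons, List.length_cons, pow_succ']
    exact mul_mem_coset_mul (pow_mem hg _) (h a (by simp)) (ih fun b hb => h b (by simp [hb]))

theorem Realizes.subset_coset {U : Multiset G} {ℓ : ℕ} {P : Finset G} (hP : Realizes U ℓ P)
    {g : G} {N : Subgroup G} (hg : g ∈ Subgroup.normalizer (N : Set G))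
    (hU : ∀ a ∈ U, a ∈ coset g N) : P ⊆ coset (g ^ ℓ) N := by
  intro p hp
  obtain ⟨l, hl, rfl, rfl⟩ := hP p hp
  exact prod_mem_coset hg l fun a ha => hU a (Multiset.mem_of_le hl (by simpa using ha))

/-- The number of terms of `T` outside the coset `xN`. -/
noncomputable def outs (x : G) (N : Subgroup G) (T : Multiset G) : ℕ :=
  T.countP (· ∉ coset x N)

theorem outs_add (x : G) (N : Subgroup G) (S T : Multiset G) :
    outs x N (S + T) = outs x N S + outs x N T :=
  Multiset.countP_add _ _ _

theorem outs_le_card (x : G) (N : Subgroup G) (T : Multiset G) : outs x N T ≤ T.card :=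
  Multiset.countP_le_card _ _

theorem outs_eq_zero {x : G} {N : Subgroup G} {T : Multiset G} (h : ∀ a ∈ T, a ∈ coset x N) :
    outs x N T = 0 :=
  Multiset.countP_eq_zero.2 fun a ha => not_not.2 (h a ha)

theorem card_filter_add_outs (x : G) (N : Subgroup G) (T : Multiset G) :
    (T.filter (· ∈ coset x N)).card + outs x N T = T.card := by
  rw [outs, ← Multiset.countP_eq_card_filter, ← Multiset.card_eq_countP_add_countP]

/-- A short subsequence `U` of `T` realizes a full coset of `N`. -/
def Fills (g : G) (N : Subgroup G) (T : Multiset G) : Prop :=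
  ∃ U ≤ T, ∃ ℓ, Realizes U ℓ (coset (g ^ ℓ) N) ∧ U.card + 1 ≤ ℓ + Nat.card N ∧ ℓ + 1 ≤ Nat.card N

theorem Fills.mono {g : G} {N : Subgroup G} {S T : Multiset G} (h : Fills g N S) (hST : S ≤ T) :
    Fills g N T := by
  obtain ⟨U, hU, h⟩ := h
  exact ⟨U, hU.trans hST, h⟩

end Realization

section Cosets

variable {G : Type*} [Group G]

theorem one_lt_card_smul_sdiff {u κ : G} {Q : Finset G} (hκ : κ ≠ 1) (hQ : op κ • Q = Q)
    (hu : u • Q ≠ Q) : 1 < #(u • Q \ Q) := by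
  obtain ⟨z, hz⟩ := card_pos.1 (card_smul_sdiff_pos hu)
  have h : op κ • (u • Q \ Q) = u • Q \ Q := by rw [smul_finset_sdiff, smul_comm, hQ]
  refine one_lt_card.2 ⟨z, hz, z * κ, ?_, by simpa using hκ⟩
  rw [← h]
  exact mem_smul_finset.2 ⟨z, hz, rfl⟩

theorem card_smul_union_smul (x b : G) (Q : Finset G) :
    #(x • Q ∪ b • Q) = #Q + #((x⁻¹ * b) • Q \ Q) := by
  have : x • Q ∪ b • Q = x • (Q ∪ (x⁻¹ * b) • Q) := by
    rw [smul_finset_union, ← mul_smul, mul_inv_cancel_left]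
  rw [this, card_smul_finset, ← union_sdiff_self_eq_union, card_union_of_disjoint disjoint_sdiff]

theorem list_prod_smul_eq {x : G} {P : Finset G} {R : Multiset G} {j : ℕ}
    (hst : ∀ i < j, ∀ b ∈ R, (x⁻¹ * b) • x ^ i • P = x ^ i • P) :
    ∀ l : List G, (∀ b ∈ l, b ∈ R) → l.length ≤ j → l.prod • P = x ^ l.length • P := by
  intro l
  induction l with
  | nil => simp
  | cons c l ih =>
    intro hl hlen
    simp only [List.length_cons] at hlen ⊢
    rw [List.prod_cons, mul_smul, ih (fun b hb => hl b (by simp [hb])) (by lia), pow_succ', mul_smul]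
    have := hst l.length (by lia) c (hl c (by simp))
    rw [mul_smul, inv_smul_eq_iff] at this
    exact this

variable [Fintype G]

theorem smul_mem_coset_mul {g x : G} {N : Subgroup G} {P : Finset G} {h : G}
    (hh : h ∈ Subgroup.normalizer (N : Set G)) (hx : x ∈ coset g N) (hP : P ⊆ coset h N) :
    x • P ⊆ coset (g * h) N := by
  intro p hp
  obtain ⟨q, hq, rfl⟩ := mem_smul_finset.1 hp
  exact mul_mem_coset_mul hh hx (hP hq)

theorem pow_mem_coset {g x : G} {N : Subgroup G} (hg : g ∈ Subgroup.normalizer (N : Set G))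
    (hx : x ∈ coset g N) (j : ℕ) : x ^ j ∈ coset (g ^ j) N := by
  simpa using prod_mem_coset hg (List.replicate j x) (by simp [hx])

/-- If no term of `R` enlarges a power translate of `P`, then `R` lies in a coset of a subgroup of
`N` normalized by `x` and having at most `|N| - |P|` elements. -/
theorem exists_normalized_subgroup {g x : G} {N : Subgroup G} {k : ℕ} {P : Finset G}
    {R : Multiset G} (hg : g ∈ Subgroup.normalizer (N : Set G)) (hx : x ∈ coset g N)
    (hR : ∀ b ∈ R, b ∈ coset g N) (hP : P ⊆ coset (g ^ k) N) (hPN : #P < Nat.card N)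
    (hst : ∀ j, ∀ b ∈ R, (x⁻¹ * b) • x ^ j • P = x ^ j • P) :
    ∃ K ≤ N, x ∈ Subgroup.normalizer (K : Set G) ∧ (∀ b ∈ R, b ∈ coset x K) ∧
      #P + Nat.card K ≤ Nat.card N := by
  have hxN := mem_normalizer_of_mem_coset hg hx
  let K : Subgroup G := N ⊓ ⨅ y : Subgroup.zpowers x,
    (MulAction.stabilizer G P).comap (MulAut.conj (y : G)⁻¹).toMonoidHom
  have memK : ∀ h, h ∈ K ↔ h ∈ N ∧ ∀ y ∈ Subgroup.zpowers x, (y⁻¹ * h * y) • P = P := by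
    intro h
    simp [K, Subgroup.mem_inf, Subgroup.mem_iInf, MulAction.mem_stabilizer_iff,
      Subgroup.mem_zpowers_iff]
  have hKN : K ≤ N := inf_le_left
  refine ⟨K, hKN, ?_, ?_, ?_⟩
  · rw [Subgroup.mem_normalizer_iff]
    intro h
    rw [memK, memK, Subgroup.mem_normalizer_iff.1 hxN h]
    refine and_congr_right fun _ => ⟨fun H y hy => ?_, fun H y hy => ?_⟩
    · have := H (x⁻¹ * y) (mul_mem (inv_mem (Subgroup.mem_zpowers x)) hy)
      simpa [mul_assoc] using this
    · have := H (x * y) (mul_mem (Subgroup.mem_zpowers x) hy)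
      simpa [mul_assoc] using this
  · intro b hb
    rw [mem_coset, memK]
    constructor
    · have := N.mul_mem (N.inv_mem (mem_coset.1 hx)) (mem_coset.1 (hR b hb))
      simpa [mul_assoc] using this
    · intro y hy
      obtain ⟨j, rfl⟩ := (Submonoid.mem_powers_iff _ _).1 (mem_powers_iff_mem_zpowers.2 hy)
      rw [mul_smul, mul_smul, hst j b hb, inv_smul_smul]
  · obtain ⟨q, hq, hqP⟩ := exists_of_ssubset (ssubset_of_subset_of_ne hP (by
      rintro rfl; exact hPN.ne (card_coset _ _)))
    have hdisj : Disjoint P (op q • coset 1 K) := by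
      rw [disjoint_right]
      intro _ hz hzP
      obtain ⟨h, hh, rfl⟩ := mem_smul_finset.1 hz
      rw [mem_coset, inv_one, one_mul] at hh
      have h1 := ((memK _).1 (K.inv_mem hh)).2 1 (one_mem _)
      apply hqP
      rw [← h1]
      exact mem_smul_finset.2 ⟨_, hzP, by simp⟩
    have hsub : P ∪ op q • coset 1 K ⊆ coset (g ^ k) N := by
      refine union_subset hP fun z hz => ?_
      obtain ⟨h, hh, rfl⟩ := mem_smul_finset.1 hz
      have := mul_mem_coset_mul (pow_mem hg k) (coset_subset_coset hKN (self_mem_coset 1 N) hh) hq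
      simpa using this
    have := card_le_card hsub
    rwa [card_union_of_disjoint hdisj, card_coset, card_smul_finset, card_coset] at this

end Cosets

section Growth

variable {G : Type*} [Group G]

theorem smul_pow_smul_eq_iff {x h : G} {P : Finset G} {j : ℕ} :
    h • x ^ j • P = x ^ j • P ↔ (x ^ j)⁻¹ * h * x ^ j ∈ MulAction.stabilizer G P := by
  rw [MulAction.mem_stabilizer_iff, mul_smul, mul_smul, inv_smul_eq_iff]

variable [Fintype G]

theorem card_stabilizer_le {x u : G} {P : Finset G} {j : ℕ} (hu : u • x ^ j • P ≠ x ^ j • P) :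
    Nat.card (MulAction.stabilizer G P) ≤ #(u • x ^ j • P \ x ^ j • P) := by
  have h := card_le_card_smul_sdiff (MulAction.stabilizer G (x ^ j • P)) u (x ^ j • P)
    (fun h hh => MulAction.mem_stabilizer_iff.1 hh) hu
  rwa [MulAction.stabilizer_smul_eq_stabilizer_map_conj,
    Subgroup.card_map_of_injective (MulAut.conj (x ^ j)).injective] at h

theorem eq_or_eq_of_card_le_two {K : Subgroup G} (hK : Nat.card K ≤ 2) {x b c : G}
    (hb : x⁻¹ * b ∈ K) (hxb : x ≠ b) (hc : x⁻¹ * c ∈ K) : c = x ∨ c = b := by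
  by_contra! h
  have hs : ({1, x⁻¹ * b, x⁻¹ * c} : Finset G) ⊆ coset 1 K := by
    intro a ha
    simp only [mem_insert, mem_singleton] at ha
    rw [mem_coset]
    rcases ha with rfl | rfl | rfl <;> simp [hb, hc, K.one_mem]
  have h3 : #({1, x⁻¹ * b, x⁻¹ * c} : Finset G) = 3 := by
    refine card_eq_three.2 ⟨_, _, _, ?_, ?_, ?_, rfl⟩
    · intro h'; exact hxb (eq_of_inv_mul_eq_one h'.symm)
    · intro h'; exact h.1 (eq_of_inv_mul_eq_one h'.symm).symm
    · intro h'; exact h.2 (mul_left_cancel h').symm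
  have := card_le_card hs
  rw [h3, card_coset] at this
  lia

theorem add_two_le_max_two_pow (j : ℕ) (h : j ≠ 1) : j + 2 ≤ max 2 (2 ^ j) := by
  match j with
  | 0 => simp
  | 1 => simp at h
  | j + 2 =>
    refine le_max_of_le_right ?_
    have : j + 1 ≤ 2 ^ j := Nat.lt_two_pow_self
    rw [pow_add]; lia

/-- A realized set `P` with a nontrivial right stabilizer can be enlarged until it fills a coset of
`N`, unless most terms of `U + R` lie in a coset of a proper subgroup of `N`. -/
theorem fills_or_exists_coset {g : G} {N : Subgroup G} (hg : g ∈ Subgroup.normalizer (N : Set G))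
    {κ : G} (hκ : κ ≠ 1) (m : ℕ) :
    ∀ (U R : Multiset G) (ℓ : ℕ) (P : Finset G), Nat.card N - #P ≤ m →
      (∀ a ∈ U + R, a ∈ coset g N) → 2 * Nat.card N ≤ (U + R).card + 1 → Realizes U ℓ P →
      ℓ + 1 ≤ #P → U.card + 1 ≤ ℓ + #P → op κ • P = P →
      Fills g N (U + R) ∨ ∃ x, ∃ K < N, x ∈ Subgroup.normalizer (K : Set G) ∧
        (∃ r ∈ R, r ∈ coset x K) ∧
        outs x K (U + R) + Nat.card K + #P ≤ outs x K U + Nat.card N := by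
  induction m with
  | zero =>
    intro U R ℓ P hm hT _ hP hℓ hU _
    have hsub := hP.subset_coset hg fun a ha => hT a (Multiset.mem_add.2 (Or.inl ha))
    have hle := card_le_card hsub
    rw [card_coset] at hle
    have heq := eq_of_subset_of_card_le hsub (by rw [card_coset]; lia)
    refine Or.inl ⟨U, Multiset.le_add_right _ _, ℓ, heq ▸ hP, by lia, by lia⟩
  | succ m ih =>
    intro U R ℓ P hm hT hN hP hℓ hU hPκ
    have hsub := hP.subset_coset hg fun a ha => hT a (Multiset.mem_add.2 (Or.inl ha))
    have hle := card_le_card hsub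
    rw [card_coset] at hle
    rcases hle.eq_or_lt with hlt | hlt
    · have heq := eq_of_subset_of_card_le hsub (by rw [card_coset]; lia)
      exact Or.inl ⟨U, Multiset.le_add_right _ _, ℓ, heq ▸ hP, by lia, by lia⟩
    have hRT : ∀ b ∈ R, b ∈ coset g N := fun b hb => hT b (Multiset.mem_add.2 (Or.inr hb))
    rw [Multiset.card_add] at hN
    obtain ⟨x, hxR⟩ := Multiset.card_pos_iff_exists_mem.1 (show 0 < R.card by lia)
    have hx := hRT x hxR
    by_cases hst : ∀ j, ∀ b ∈ R, (x⁻¹ * b) • x ^ j • P = x ^ j • P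
    · obtain ⟨K, hKN, hxK, hRK, hcard⟩ := exists_normalized_subgroup hg hx hRT hsub hlt hst
      refine Or.inr ⟨x, K, hKN.lt_of_ne ?_, hxK, ⟨x, hxR, self_mem_coset x K⟩, ?_⟩
      · rintro rfl; lia
      · rw [outs_add, outs_eq_zero hRK]; lia
    have hex : ∃ j, ∃ b ∈ R, (x⁻¹ * b) • x ^ j • P ≠ x ^ j • P := by push Not at hst; exact hst
    obtain ⟨b, hbR, hb⟩ := Nat.find_spec hex
    have hmin : ∀ i < Nat.find hex, ∀ c ∈ R, (x⁻¹ * c) • x ^ i • P = x ^ i • P := by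
      intro i hi
      have := Nat.find_min hex hi
      push Not at this
      exact this
    generalize Nat.find hex = j at hb hmin
    have hxb : x ≠ b := by rintro rfl; simp at hb
    set d := #((x⁻¹ * b) • x ^ j • P \ x ^ j • P) with hd
    have hd2 : 1 < d := one_lt_card_smul_sdiff hκ (by rw [smul_comm, hPκ]) hb
    have hcd : Nat.card (MulAction.stabilizer G P) ≤ d := card_stabilizer_le hb
    have hj : 2 ^ j ≤ Nat.card (MulAction.stabilizer G P) :=
      two_pow_le_card_of_conj_mem (x := x) (h := x⁻¹ * b) j _
        (fun i hi => smul_pow_smul_eq_iff.1 (hmin i hi b hbR)) (mt smul_pow_smul_eq_iff.2 hb)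
    have hjlt : j + 1 ≤ 2 ^ j := Nat.lt_two_pow_self
    set P' := x • x ^ j • P ∪ b • x ^ j • P with hP'
    have hP'card : #P' = #P + d := by rw [hP', card_smul_union_smul, card_smul_finset]
    have hP'sub : P' ⊆ coset (g * (g ^ j * g ^ ℓ)) N := by
      have h1 : x ^ j • P ⊆ coset (g ^ j * g ^ ℓ) N :=
        smul_mem_coset_mul (pow_mem hg _) (pow_mem_coset hg hx j) hsub
      have h2 := mul_mem (pow_mem hg j) (pow_mem hg ℓ)
      exact union_subset (smul_mem_coset_mul h2 hx h1) (smul_mem_coset_mul h2 (hRT b hbR) h1)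
    have hP'le := card_le_card hP'sub
    rw [card_coset] at hP'le
    obtain ⟨R₁, hR₁⟩ := Multiset.exists_cons_of_mem hxR
    have hbR₁ : b ∈ R₁ := (Multiset.mem_cons.1 (hR₁ ▸ hbR)).resolve_left hxb.symm
    obtain ⟨R₂, rfl⟩ := Multiset.exists_cons_of_mem hbR₁
    have hRcard : R.card = R₂.card + 2 := by simp [hR₁]
    obtain ⟨V, hV, hVj⟩ := Multiset.exists_le_card_eq (show j ≤ R₂.card by lia)
    obtain ⟨R', rfl⟩ := Multiset.le_iff_exists_add.1 hV
    obtain ⟨v, rfl⟩ : ∃ v : List G, (v : Multiset G) = V := ⟨V.toList, V.coe_toList⟩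
    rw [Multiset.coe_card] at hVj
    set W : Multiset G := x ::ₘ b ::ₘ (v : Multiset G) with hW
    have hR : R = W + R' := by rw [hR₁, hW, Multiset.cons_add, Multiset.cons_add]
    have hWcard : W.card = j + 2 := by simp [hW, hVj]
    have hvP : v.prod • P = x ^ j • P := by
      rw [← hVj]
      exact list_prod_smul_eq hmin v (fun c hc => by rw [hR, hW]; simp [hc]) hVj.le
    have hP'r : Realizes (U + W) (ℓ + (j + 1)) P' := by
      have h1 := hP.prod_smul (l := x :: v) (W := W) (by
        rw [← Multiset.cons_coe]; exact (Multiset.cons_le_cons_iff x).2 (Multiset.le_cons_self _ b))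
      have h2 := hP.prod_smul (l := b :: v) (W := W) (by
        rw [← Multiset.cons_coe]; exact Multiset.le_cons_self _ x)
      rw [List.prod_cons, mul_smul, hvP, List.length_cons, hVj] at h1 h2
      exact h1.union h2
    have hP'κ : op κ • P' = P' := by
      rw [hP', smul_finset_union, smul_comm (op κ) x, smul_comm (op κ) b, smul_comm (op κ) (x ^ j),
        hPκ]
    have hadd : U + R = U + W + R' := by rw [hR, add_assoc]
    have := ih (U + W) R' (ℓ + (j + 1)) P' (by lia) (by rwa [← hadd])
      (by rw [← hadd, Multiset.card_add]; exact hN) hP'r (by lia)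
      (by rw [Multiset.card_add]; lia) hP'κ
    rw [← hadd] at this
    refine this.imp_right ?_
    rintro ⟨y, K, hKN, hyK, ⟨r, hr, hrK⟩, hout⟩
    refine ⟨y, K, hKN, hyK, ⟨r, by simp [hR, hr], hrK⟩, ?_⟩
    rw [outs_add y K U W] at hout
    suffices outs y K W ≤ d by lia
    have hWle := outs_le_card y K W
    by_cases hjd : j + 2 ≤ d
    · lia
    have hj1 : j = 1 := by
      by_contra hj1
      have := add_two_le_max_two_pow j hj1
      lia
    subst hj1
    have hrxb : r = x ∨ r = b := by
      refine eq_or_eq_of_card_le_two (K := MulAction.stabilizer G P) (by lia) ?_ hxb ?_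
      · simpa using hmin 0 (by lia) b hbR
      · simpa using hmin 0 (by lia) r (by simp [hR, hr])
    have hlt : outs y K W < W.card := by
      refine lt_of_le_of_ne hWle fun h => ?_
      refine Multiset.countP_eq_card.1 h r ?_ hrK
      rcases hrxb with rfl | rfl <;> simp [hW]
    lia

end Growth

section Balance

variable {G : Type*} [Group G]

/-- Either at most `t` terms of `U` lie outside `C`, or no element of `C` occurs much more often
in `R` than some element outside `C`. -/
def IsBalanced {α : Type*} (U R : Multiset α) (t : ℕ) : Prop :=
  ∀ C : Finset α, ∀ z ∈ C, U.countP (· ∉ C) ≤ t ∨ ∃ x ∉ C, R.count z ≤ R.count x + 1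

theorem IsBalanced.step {α : Type*} {U R : Multiset α} {t : ℕ} {a b : α}
    (h : IsBalanced U (a ::ₘ b ::ₘ R) t) (hab : a ≠ b)
    (ha : ∀ z, (a ::ₘ b ::ₘ R).count z ≤ (a ::ₘ b ::ₘ R).count a)
    (hb : ∀ z ≠ a, (a ::ₘ b ::ₘ R).count z ≤ (a ::ₘ b ::ₘ R).count b) :
    IsBalanced (a ::ₘ b ::ₘ U) R (t + 1) := by
  intro C z hz
  simp only [Multiset.count_cons, Multiset.countP_cons] at *
  rcases h C z hz with h | ⟨x, hx, h⟩
  · by_cases hC : a ∈ C ∨ b ∈ C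
    · left; rcases hC with hC | hC <;> simp only [hC] <;> split_ifs <;> simp at * <;> lia
    · right
      push Not at hC
      refine ⟨a, hC.1, ?_⟩
      have hza : z ≠ a := by rintro rfl; exact hC.1 hz
      have hzb : z ≠ b := by rintro rfl; exact hC.2 hz
      have := ha z
      simp [hza, hzb, hab] at this
      lia
  · right
    refine ⟨x, hx, ?_⟩
    have h1 := ha z
    have h2 := hb z
    have hzx : z ≠ x := by rintro rfl; exact hx hz
    simp only [Multiset.count_cons] at h
    simp [hab, hab.symm] at h1 h2
    grind

theorem card_op_smul_union_op_smul {a b : G} (hab : a ≠ b) {P : Finset G}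
    (hP : ∀ κ ≠ (1 : G), op κ • P ≠ P) : #P + 1 ≤ #(op a • P ∪ op b • P) := by
  by_contra! h
  have h1 : #(op a • P) = #P := card_smul_finset _ _
  have h2 : #(op b • P) = #P := card_smul_finset _ _
  have h3 := eq_of_subset_of_card_le (subset_union_left (s₁ := op a • P) (s₂ := op b • P)) (by lia)
  have h4 := eq_of_subset_of_card_le (subset_union_right (s₁ := op a • P) (s₂ := op b • P)) (by lia)
  refine hP (b * a⁻¹) (fun h => hab (mul_inv_eq_one.1 h).symm) ?_
  rw [op_mul, mul_smul, h4, ← h3, ← mul_smul, ← op_mul, mul_inv_cancel, op_one, one_smul]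

/-- Removing pairs of the most frequent distinct terms of `R` enlarges the realized set until it has
a nontrivial right stabilizer or `R` is constant. -/
theorem exists_realizes_balanced (m : ℕ) : ∀ (U R : Multiset G) (t : ℕ) (P : Finset G),
    R.card ≤ m → Realizes U t P → U.card = 2 * t → t + 1 ≤ #P → IsBalanced U R t →
    ∃ (U' R' : Multiset G) (t' : ℕ) (P' : Finset G), U' + R' = U + R ∧ Realizes U' t' P' ∧
      U'.card = 2 * t' ∧ t' + 1 ≤ #P' ∧ IsBalanced U' R' t' ∧
      ((∃ κ ≠ (1 : G), op κ • P' = P') ∨ ∃ c, ∀ b ∈ R', b = c) := by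
  induction m with
  | zero =>
    intro U R t P hm hP hU ht hbal
    refine ⟨U, R, t, P, rfl, hP, hU, ht, hbal, Or.inr ⟨1, fun b hb => ?_⟩⟩
    exact absurd (Multiset.card_pos_iff_exists_mem.2 ⟨b, hb⟩) (by lia)
  | succ m ih =>
    intro U R t P hm hP hU ht hbal
    by_cases hdone : (∃ κ ≠ (1 : G), op κ • P = P) ∨ ∃ c, ∀ b ∈ R, b = c
    · exact ⟨U, R, t, P, rfl, hP, hU, ht, hbal, hdone⟩
    push Not at hdone
    obtain ⟨hκ, hR⟩ := hdone
    obtain ⟨r, hr, -⟩ := hR 1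
    obtain ⟨a, ha, hamax⟩ := R.toFinset.exists_max_image (fun z => R.count z) ⟨r, by simpa using hr⟩
    obtain ⟨b', hb', hb'a⟩ := hR a
    obtain ⟨b, hb, hbmax⟩ := (R.toFinset.erase a).exists_max_image (fun z => R.count z)
      ⟨b', by simpa using ⟨hb'a, hb'⟩⟩
    simp only [mem_erase, Multiset.mem_toFinset] at ha hamax hb hbmax
    obtain ⟨R₁, rfl⟩ := Multiset.exists_cons_of_mem ha
    obtain ⟨R₂, rfl⟩ := Multiset.exists_cons_of_mem ((Multiset.mem_cons.1 hb.2).resolve_left hb.1)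
    have hmax₁ : ∀ z, (a ::ₘ b ::ₘ R₂).count z ≤ (a ::ₘ b ::ₘ R₂).count a := by
      intro z
      by_cases hz : z ∈ a ::ₘ b ::ₘ R₂
      · exact hamax z hz
      · rw [Multiset.count_eq_zero_of_notMem hz]; exact Nat.zero_le _
    have hmax₂ : ∀ z ≠ a, (a ::ₘ b ::ₘ R₂).count z ≤ (a ::ₘ b ::ₘ R₂).count b := by
      intro z hza
      by_cases hz : z ∈ a ::ₘ b ::ₘ R₂
      · exact hbmax z ⟨hza, hz⟩
      · rw [Multiset.count_eq_zero_of_notMem hz]; exact Nat.zero_le _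
    have hadd : U + (a ::ₘ b ::ₘ R₂) = (a ::ₘ b ::ₘ U) + R₂ := by
      simp only [Multiset.add_cons, Multiset.cons_add]
    have hU' : a ::ₘ b ::ₘ U = U + {a, b} := by
      simp only [Multiset.insert_eq_cons, ← Multiset.singleton_add]
      abel
    have hP' : Realizes (a ::ₘ b ::ₘ U) (t + 1) (op a • P ∪ op b • P) := by
      rw [hU']
      exact (hP.op_smul (by simp)).union (hP.op_smul (by simp))
    have hcard := card_op_smul_union_op_smul (Ne.symm hb.1) hκ
    rw [hadd]
    simp only [Multiset.card_cons] at hm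
    exact ih _ _ _ _ (by lia) hP' (by simp only [Multiset.card_cons]; lia) (by lia)
      (hbal.step (Ne.symm hb.1) hmax₁ hmax₂)

variable [Fintype G]

theorem op_smul_coset {κ : G} {M : Subgroup G} (hκ : κ ∈ M) (c : G) :
    op κ • coset c M = coset c M := by
  refine eq_of_subset_of_card_le (fun z hz => ?_) (by rw [card_smul_finset])
  obtain ⟨p, hp, rfl⟩ := mem_smul_finset.1 hz
  rw [mem_coset] at *
  simpa [mul_assoc] using M.mul_mem hp hκ

theorem card_smul_coset_union_smul_coset {c y b g : G} {M : Subgroup G}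
    (hc : c ∈ Subgroup.normalizer (M : Set G)) (hy : y ∈ coset g M) (hb : b ∉ coset g M) :
    #(y • coset c M ∪ b • coset c M) = 2 * Nat.card M := by
  rw [card_smul_union_smul, sdiff_eq_self_of_disjoint, card_smul_finset, card_coset, two_mul]
  rw [disjoint_left]
  intro z hz hzc
  obtain ⟨p, hp, rfl⟩ := mem_smul_finset.1 hz
  rw [mem_coset] at *
  have h1 := M.mul_mem hzc (M.inv_mem hp)
  have h2 := (Subgroup.mem_normalizer_iff.1 hc _).1 h1
  refine hb ?_
  simpa [mul_assoc] using M.mul_mem hy h2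

/-- If no coset of a proper subgroup of `N` contains too many terms of `T`, then filling a coset of
a proper nontrivial subgroup suffices to fill a coset of `N`. -/
theorem fills_of_fills {g g' : G} {N M : Subgroup G} {T : Multiset G}
    (hg : g ∈ Subgroup.normalizer (N : Set G)) (hT : ∀ a ∈ T, a ∈ coset g N)
    (hN : 2 * Nat.card N ≤ T.card + 1)
    (hT' : ∀ x, ∀ K < N, x ∈ Subgroup.normalizer (K : Set G) →
      Nat.card N < outs x K T + Nat.card K)
    (hM : M < N) (hM' : M ≠ ⊥) (hg' : g' ∈ Subgroup.normalizer (M : Set G))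
    (hfill : Fills g' M (T.filter (· ∈ coset g' M)))
    (hcard : 2 * Nat.card M ≤ (T.filter (· ∈ coset g' M)).card + 1) : Fills g N T := by
  obtain ⟨U, hU, ℓ, hP, hUℓ, hℓ⟩ := hfill
  obtain ⟨κ, hκM, hκ⟩ := M.bot_or_exists_ne_one.resolve_left hM'
  obtain ⟨Y, hY⟩ := Multiset.le_iff_exists_add.1 hU
  have hYcard : 0 < Y.card := by
    rw [hY, Multiset.card_add] at hcard; lia
  obtain ⟨y, hy⟩ := Multiset.card_pos_iff_exists_mem.1 hYcard
  have hyM : y ∈ coset g' M :=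
    (Multiset.mem_filter.1 (hY ▸ Multiset.mem_add.2 (Or.inr hy))).2
  obtain ⟨Y, rfl⟩ := Multiset.exists_cons_of_mem hy
  have hMN := Subgroup.card_le_of_le hM.le
  have hout := hT' g' M hM hg'
  obtain ⟨b, hbT, hb⟩ := Multiset.countP_pos.1 (show 0 < outs g' M T by lia)
  have hZ := Multiset.filter_add_not (· ∈ coset g' M) T
  obtain ⟨Z, hbZ⟩ := Multiset.exists_cons_of_mem
    (s := T.filter (· ∉ coset g' M)) (Multiset.mem_filter.2 ⟨hbT, hb⟩)
  have hTU : T = (U + {y, b}) + (Y + Z) := by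
    rw [← hZ, hbZ, hY]
    simp only [Multiset.insert_eq_cons, ← Multiset.singleton_add]
    abel
  have hP' : Realizes (U + {y, b}) (ℓ + 1) (y • coset (g' ^ ℓ) M ∪ b • coset (g' ^ ℓ) M) := by
    have h1 := hP.prod_smul (W := {y, b}) (l := [y]) (by simp)
    have h2 := hP.prod_smul (W := {y, b}) (l := [b]) (by simp)
    simp only [List.prod_singleton, List.length_singleton] at h1 h2
    exact h1.union h2
  have hP'card := card_smul_coset_union_smul_coset (pow_mem hg' ℓ) hyM hb
  have hU'card : (U + {y, b}).card = U.card + 2 := by simp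
  have hκP : op κ • (y • coset (g' ^ ℓ) M ∪ b • coset (g' ^ ℓ) M) =
      y • coset (g' ^ ℓ) M ∪ b • coset (g' ^ ℓ) M := by
    rw [smul_finset_union, smul_comm _ y, smul_comm _ b, op_smul_coset hκM]
  rw [hTU] at hT hN
  rcases fills_or_exists_coset hg hκ _ (U + {y, b}) (Y + Z) (ℓ + 1) _ le_rfl hT hN hP' (by lia)
    (by lia) hκP with h | ⟨x, K, hKN, hxK, -, h⟩
  · rwa [← hTU] at h
  · rw [← hTU] at h
    have := hT' x K hKN hxK
    have := outs_le_card x K (U + {y, b})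
    lia

end Balance

section Filling

variable {G : Type*} [Group G] [Fintype G]

theorem outs_le_outs_add_outs_filter (g' x : G) (M K : Subgroup G) (T : Multiset G) :
    outs g' M T ≤ outs x K T + outs g' M (T.filter (· ∈ coset x K)) := by
  have h := outs_add g' M (T.filter (· ∈ coset x K)) (T.filter (· ∉ coset x K))
  rw [Multiset.filter_add_not] at h
  have h2 := outs_le_card g' M (T.filter (· ∉ coset x K))
  rw [← Multiset.countP_eq_card_filter, ← outs] at h2
  lia

theorem card_lt_card_of_lt {K N : Subgroup G} (h : K < N) : Nat.card K < Nat.card N :=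
  lt_of_le_of_ne (Subgroup.card_le_of_le h.le)
    fun he => h.ne (Subgroup.eq_of_le_of_card_ge h.le he.ge)

theorem count_le_outs {w x : G} {K : Subgroup G} (hw : w ∉ coset x K) (R : Multiset G) :
    R.count w ≤ outs x K R := by
  rw [← Multiset.count_filter_of_pos (p := (· ∉ coset x K)) hw, outs,
    Multiset.countP_eq_card_filter]
  exact Multiset.count_le_card _ _

theorem card_filter_coset_bot (g : G) (R : Multiset G) :
    (R.filter (· ∈ coset g ⊥)).card = R.count g := by
  rw [Multiset.count_eq_card_filter_eq]
  congr 1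
  refine Multiset.filter_congr fun a _ => ?_
  rw [mem_coset, Subgroup.mem_bot, inv_mul_eq_one]

/-- Pairing up the terms of `T` as far as possible produces either a filled coset of `N` or an
unbalanced coset of a proper subgroup. -/
theorem fills_or_exists_balanced {g : G} {N : Subgroup G} {T : Multiset G}
    (hg : g ∈ Subgroup.normalizer (N : Set G)) (hT : ∀ a ∈ T, a ∈ coset g N)
    (hN : 2 * Nat.card N ≤ T.card + 1) :
    Fills g N T ∨ ∃ (U R : Multiset G) (t : ℕ) (p : ℕ) (x : G), ∃ K < N, U + R = T ∧
      U.card = 2 * t ∧ t + 1 ≤ p ∧ IsBalanced U R t ∧ x ∈ Subgroup.normalizer (K : Set G) ∧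
      outs x K T + Nat.card K + p ≤ outs x K U + Nat.card N := by
  obtain ⟨U, R, t, P, hUR, hP, hU, ht, hbal, hend⟩ :=
    exists_realizes_balanced T.card 0 T 0 {1} le_rfl
      (fun p hp => ⟨[], by simp, by simp, by simpa using (mem_singleton.1 hp).symm⟩) (by simp)
    (by simp) (fun C z _ => Or.inl (by simp))
  rw [zero_add] at hUR
  subst hUR
  rcases hend with ⟨κ, hκ, hPκ⟩ | ⟨c, hc⟩
  · rcases fills_or_exists_coset hg hκ _ U R t P le_rfl hT hN hP ht (by lia) hPκ with
      h | ⟨x, K, hKN, hxK, -, h⟩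
    · exact Or.inl h
    · exact Or.inr ⟨U, R, t, #P, x, K, hKN, rfl, hU, ht, hbal, hxK, h⟩
  · have hsub := hP.subset_coset hg fun a ha => hT a (Multiset.mem_add.2 (Or.inl ha))
    have hle := card_le_card hsub
    rw [card_coset] at hle
    rcases hle.eq_or_lt with hlt | hlt
    · have heq := eq_of_subset_of_card_le hsub (by rw [card_coset]; lia)
      exact Or.inl ⟨U, Multiset.le_add_right _ _, t, heq ▸ hP, by lia, by lia⟩
    · refine Or.inr ⟨U, R, t, #P, c, ⊥, bot_lt_iff_ne_bot.2 ?_, rfl, hU, ht, hbal, ?_, ?_⟩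
      · rintro rfl
        rw [Subgroup.card_bot] at hlt
        lia
      · exact Subgroup.mem_normalizer_iff.2 (by simp)
      · have hR : outs c ⊥ R = 0 := outs_eq_zero fun a ha => hc a ha ▸ self_mem_coset a ⊥
        rw [outs_add, hR, Subgroup.card_bot]
        lia

/-- A sequence of at least `2|N| - 1` terms of a normalizing coset `gN` fills a coset of some
subgroup `M` of `N` outside of which there are at most `|N| - |M|` terms. -/
theorem exists_fills (n : ℕ) : ∀ (g : G) (N : Subgroup G) (T : Multiset G), Nat.card N ≤ n →
    g ∈ Subgroup.normalizer (N : Set G) → (∀ a ∈ T, a ∈ coset g N) →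
    2 * Nat.card N ≤ T.card + 1 → ∃ M ≤ N, ∃ g' ∈ Subgroup.normalizer (M : Set G),
      outs g' M T + Nat.card M ≤ Nat.card N ∧ Fills g' M (T.filter (· ∈ coset g' M)) := by
  induction n with
  | zero => intro g N T hn; exact absurd hn (by simp)
  | succ n ih =>
    intro g N T hn hg hT hN
    by_cases hT' : ∀ x, ∀ K < N, x ∈ Subgroup.normalizer (K : Set G) →
      Nat.card N < outs x K T + Nat.card K
    · refine ⟨N, le_rfl, g, hg, by rw [outs_eq_zero hT, zero_add], ?_⟩
      rw [Multiset.filter_eq_self.2 hT]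
      rcases fills_or_exists_balanced hg hT hN with
        h | ⟨U, R, t, p, x, K, hKN, hUR, hU, ht, hbal, hxK, h⟩
      · exact h
      have hlt := card_lt_card_of_lt hKN
      have h₁ := hT' x K hKN hxK
      have h₂ := outs_add x K U R
      have h₃ := card_filter_add_outs x K R
      have h₄ := Multiset.card_add U R
      rw [hUR] at h₂ h₄
      obtain ⟨M, hMK, g', hg', hout, hfill⟩ := ih x K (R.filter (· ∈ coset x K)) (by lia) hxK
        (fun a ha => (Multiset.mem_filter.1 ha).2) (by lia)
      have h₅ := card_filter_add_outs g' M (R.filter (· ∈ coset x K))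
      have h₆ := Subgroup.card_le_of_le hMK
      have hle : (R.filter (· ∈ coset x K)).filter (· ∈ coset g' M) ≤
          T.filter (· ∈ coset g' M) :=
        Multiset.filter_le_filter _
          ((Multiset.filter_le _ _).trans (hUR ▸ Multiset.le_add_left _ _))
      have hle' := Multiset.card_le_card hle
      refine fills_of_fills hg hT hN hT' (hMK.trans_lt hKN) ?_ hg' (hfill.mono hle) (by lia)
      rintro rfl
      obtain ⟨a, ha⟩ := Multiset.card_pos_iff_exists_mem.1 (show 0 <
        ((R.filter (· ∈ coset x K)).filter (· ∈ coset g' ⊥)).card by lia)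
      simp only [Multiset.mem_filter, mem_coset, Subgroup.mem_bot, inv_mul_eq_one] at ha
      obtain ⟨⟨-, hx⟩, rfl⟩ := ha
      rw [card_filter_coset_bot] at h₅
      have h₇ := Multiset.count_le_of_le g' (Multiset.filter_le (· ∈ coset x K) R)
      have h₈ : 0 < Nat.card K := Nat.card_pos
      rcases hbal (coset x K) g' (mem_coset.2 hx) with h₉ | ⟨w, hw, h₉⟩
      · rw [← outs] at h₉; lia
      · have := count_le_outs hw R; lia
    · push Not at hT'
      obtain ⟨x, K, hKN, hxK, hK⟩ := hT'
      have hlt := card_lt_card_of_lt hKN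
      have h₁ := card_filter_add_outs x K T
      obtain ⟨M, hMK, g', hg', hout, hfill⟩ := ih x K (T.filter (· ∈ coset x K)) (by lia) hxK
        (fun a ha => (Multiset.mem_filter.1 ha).2) (by lia)
      have h₂ := outs_le_outs_add_outs_filter g' x M K T
      exact ⟨M, hMK.trans hKN.le, g', hg', by lia,
        hfill.mono (Multiset.filter_le_filter _ (Multiset.filter_le _ _))⟩

theorem exists_prod_eq_one_of_card_eq {S : Multiset G} (hS : S.card = 2 * Nat.card G - 1) :
    ∃ l : List G, (l : Multiset G) ≤ S ∧ l.length = Nat.card G ∧ l.prod = 1 := by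
  have hG : 0 < Nat.card G := Nat.card_pos
  obtain ⟨M, -, g, hg, hout, U, hU, ℓ, hP, hUℓ, hℓ⟩ := exists_fills (Nat.card G) 1 ⊤ S
    (by simp) (one_mem _) (by simp [mem_coset]) (by rw [Subgroup.card_top]; lia)
  rw [Subgroup.card_top] at hout
  have hcard := card_filter_add_outs g M S
  obtain ⟨Y, hY⟩ := Multiset.le_iff_exists_add.1 hU
  rw [hY, Multiset.card_add] at hcard
  obtain ⟨W, hW, hWcard⟩ := Multiset.exists_le_card_eq (show Nat.card G - ℓ ≤ Y.card by lia)
  obtain ⟨w, rfl⟩ : ∃ w : List G, (w : Multiset G) = W := ⟨W.toList, W.coe_toList⟩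
  rw [Multiset.coe_card] at hWcard
  have hMG := Subgroup.card_le_card_group M
  have hw : w.prod ∈ coset (g ^ (Nat.card G - ℓ)) M := by
    rw [← hWcard]
    refine prod_mem_coset hg w fun a ha => ?_
    have haS : a ∈ S.filter (· ∈ coset g M) := by
      rw [hY]
      exact Multiset.mem_add.2 (Or.inr (Multiset.mem_of_le hW (by simpa using ha)))
    exact (Multiset.mem_filter.1 haS).2
  have hgw : g ^ (Nat.card G - ℓ) = (g ^ ℓ)⁻¹ := by
    rw [eq_inv_iff_mul_eq_one, ← pow_add, Nat.sub_add_cancel (by lia), pow_card_eq_one']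
  have hp : w.prod⁻¹ ∈ coset (g ^ ℓ) M := by
    rw [mem_coset, hgw, inv_inv] at hw
    rw [mem_coset, ← mul_inv_rev]
    refine M.inv_mem ?_
    have := (Subgroup.mem_normalizer_iff.1 (inv_mem (pow_mem hg ℓ)) _).1 hw
    simpa [mul_assoc] using this
  obtain ⟨l, hl, hlℓ, hlp⟩ := hP _ hp
  refine ⟨l ++ w, ?_, by rw [List.length_append, hlℓ, hWcard]; lia, by simp [hlp]⟩
  rw [← Multiset.coe_add]
  exact (add_le_add hl hW).trans (hY ▸ Multiset.filter_le _ _)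

end Filling

end ProductOne

theorem stmt_16 (G : Type*) [Group G] [Fintype G] :
    (∀ S : Multiset G, Multiset.card S = 2 * Fintype.card G - 1 →
      ∃ T, T ≤ S ∧ Multiset.card T = Fintype.card G ∧ (1 : G) ∈ piSet T) ∧
    EG G ≤ 2 * Fintype.card G - 1 := by
  have key : ∀ S : Multiset G, Multiset.card S = 2 * Fintype.card G - 1 →
      ∃ T, T ≤ S ∧ Multiset.card T = Fintype.card G ∧ (1 : G) ∈ piSet T := by
    intro S hS
    rw [Fintype.card_eq_nat_card] at hS ⊢
    obtain ⟨l, hl, hlen, hprod⟩ := exists_prod_eq_one_of_card_eq hS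
    exact ⟨l, hl, hlen, l, rfl, hprod⟩
  exact ⟨key, Nat.sInf_le key⟩
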